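/- arXiv:2509.00170 — 9 statements merged into one kernel-verified Lean document; each statement's English description precedes it below -/
import Mathlib

section
/- Let G be a simple, undirected, unweighted graph. Then gc(G) = 2 if and only if there exist a, b ∈ ℕ with (a, b) ≠ (1, 1) such that G is the disjoint union of cliques K_a ∪ K_b or the complete bipartite graph K_{a,b}. -/
open Matrix

def GCFeasible {V : Type*} [Fintype V] (A : Matrix V V ℝ) (m : ℕ) : Prop :=
  ∃ (k : ℕ) (P : Matrix (Fin k) V ℝ) (w : Fin k → ℝ),
    (∀ p i, P p i = 1 ∨ P p i = -1) ∧
    (∀ i, A i i = 0) ∧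
    (∀ i j, i ≠ j → A i j = (Pᵀ * Matrix.diagonal w * P) i j) ∧
    m = (Finset.univ.filter fun p => w p ≠ 0).card

noncomputable def gc {V : Type*} [Fintype V] (A : Matrix V V ℝ) : ℕ :=
  sInf { m | GCFeasible A m }

open scoped Classical in
noncomputable def gcGraph {V : Type*} [Fintype V] (G : SimpleGraph V) : ℕ :=
  gc (Matrix.of fun u v => if G.Adj u v then (1 : ℝ) else 0)

lemma Matrix.transpose_mul_diagonal_mul_apply {V : Type*} {k : ℕ} (P : Matrix (Fin k) V ℝ)
    (w : Fin k → ℝ)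
    (i j : V) : (Pᵀ * Matrix.diagonal w * P) i j = ∑ p, w p * (P p i * P p j) := by
  rw [Matrix.mul_apply]
  simp only [Matrix.mul_diagonal, Matrix.transpose_apply]
  exact Finset.sum_congr rfl fun _ _ => by ring

lemma adj_iff_ne_zero_of_adjMatrix_eq {V : Type*} (G : SimpleGraph V)
    [DecidableRel G.Adj] {u v : V} {c : ℝ}
    (h : G.adjMatrix ℝ u v = c ∨ G.adjMatrix ℝ u v = -c) : G.Adj u v ↔ c ≠ 0 := by
  rw [SimpleGraph.adjMatrix_apply] at h
  by_cases hG : G.Adj u v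
  · simp only [hG, if_true, true_iff] at h ⊢
    rintro rfl
    simp at h
  · simpa [hG, eq_comm] using h

section Feasibility

variable {V : Type*} [Fintype V]

/-- Only the rows carrying a nonzero weight contribute to a coupling. -/
lemma GCFeasible.exists_sum_eq {A : Matrix V V ℝ} {m : ℕ} (h : GCFeasible A m) :
    ∃ (k : ℕ) (P : Matrix (Fin k) V ℝ) (w : Fin k → ℝ) (s : Finset (Fin k)),
      (∀ p i, P p i = 1 ∨ P p i = -1) ∧ s.card = m ∧ (∀ p ∈ s, w p ≠ 0) ∧
      ∀ i j, i ≠ j → A i j = ∑ p ∈ s, w p * (P p i * P p j) := by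
  obtain ⟨k, P, w, hP, -, hA, rfl⟩ := h
  refine ⟨k, P, w, _, hP, rfl, by simp, fun i j hij => ?_⟩
  rw [hA i j hij, Matrix.transpose_mul_diagonal_mul_apply, Finset.sum_filter_of_ne]
  rintro p - hp h0
  simp [h0] at hp

/-- Coupling certificates in coordinates. -/
lemma GCFeasible.of_sum_eq {A : Matrix V V ℝ} {k : ℕ} (P : Fin k → V → ℝ) (w : Fin k → ℝ)
    (hP : ∀ p i, P p i = 1 ∨ P p i = -1) (hw : ∀ p, w p ≠ 0) (hdiag : ∀ i, A i i = 0)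
    (hA : ∀ i j, i ≠ j → A i j = ∑ p, w p * (P p i * P p j)) : GCFeasible A k := by
  refine ⟨k, Matrix.of P, w, hP, hdiag, fun i j hij => ?_, by simp [hw]⟩
  rw [hA i j hij, Matrix.transpose_mul_diagonal_mul_apply]
  rfl

variable (G : SimpleGraph V) [DecidableRel G.Adj]

lemma gcFeasible_adjMatrix_zero_iff : GCFeasible (G.adjMatrix ℝ) 0 ↔ G = ⊥ := by
  constructor
  · intro h
    obtain ⟨k, P, w, s, -, hs, -, hA⟩ := h.exists_sum_eq
    rw [Finset.card_eq_zero] at hs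
    subst hs
    rw [SimpleGraph.eq_bot_iff_forall_not_adj]
    intro i j hij
    simpa [hij] using hA i j hij.ne
  · rintro rfl
    exact ⟨0, 0, 0, by simp, by simp, by simp, by simp⟩

lemma eq_top_of_gcFeasible_adjMatrix_one (h : GCFeasible (G.adjMatrix ℝ) 1) : G = ⊤ := by
  obtain ⟨k, P, w, s, hP, hs, hw, hA⟩ := h.exists_sum_eq
  obtain ⟨x, rfl⟩ := Finset.card_eq_one.1 hs
  rw [SimpleGraph.eq_top_iff_forall_ne_adj]
  intro i j hij
  by_contra hG
  have := hA i j hij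
  have hx := hw x (by simp)
  rcases hP x i with hi | hi <;> rcases hP x j with hj | hj <;> simp_all

lemma gcFeasible_adjMatrix_one_of_eq_top (h : G = ⊤) : GCFeasible (G.adjMatrix ℝ) 1 := by
  subst h
  exact .of_sum_eq (fun _ _ => 1) (fun _ => 1) (by simp) (by simp) (by simp)
    fun i j hij => by simp [hij]

/-- Two rows, with weights of equal modulus, suffice when adjacency only depends on a
bipartition. -/
lemma gcFeasible_adjMatrix_two_of_bipartition (S : Finset V)
    (h : (∀ u v, G.Adj u v ↔ u ≠ v ∧ (u ∈ S ↔ v ∈ S)) ∨ (∀ u v, G.Adj u v ↔ ¬(u ∈ S ↔ v ∈ S))) :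
    GCFeasible (G.adjMatrix ℝ) 2 := by
  classical
  have hP : ∀ (p : Fin 2) (i : V), ![fun _ => 1, fun v => if v ∈ S then (1 : ℝ) else -1] p i = 1 ∨
      ![fun _ => 1, fun v => if v ∈ S then (1 : ℝ) else -1] p i = -1 := by
    intro p i
    fin_cases p <;> by_cases hi : i ∈ S <;> simp [hi]
  rcases h with h | h
  · refine .of_sum_eq _ (fun _ => 1 / 2) hP (by simp) (by simp) fun i j hij => ?_
    by_cases hi : i ∈ S <;> by_cases hj : j ∈ S <;>
      simp [Fin.sum_univ_two, h, hij, hi, hj] <;> norm_num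
  · refine .of_sum_eq _ ![1 / 2, -1 / 2] hP (fun p => by fin_cases p <;> simp) (by simp)
      fun i j hij => ?_
    by_cases hi : i ∈ S <;> by_cases hj : j ∈ S <;>
      simp [Fin.sum_univ_two, h, hi, hj] <;> norm_num

/-- A graph with a two-row coupling, neither empty nor complete, is a disjoint union of two
nonempty cliques or a complete bipartite graph with nonempty parts. -/
lemma exists_bipartition_of_gcFeasible_adjMatrix_two (h : GCFeasible (G.adjMatrix ℝ) 2)
    (hbot : G ≠ ⊥) (htop : G ≠ ⊤) :
    ∃ S : Finset V, (∃ u, u ∈ S) ∧ (∃ u, u ∉ S) ∧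
      ((∀ u v, G.Adj u v ↔ u ≠ v ∧ (u ∈ S ↔ v ∈ S)) ∨
        (∀ u v, G.Adj u v ↔ ¬(u ∈ S ↔ v ∈ S))) := by
  classical
  obtain ⟨k, P, w, s, hP, hs, hw, hA⟩ := h.exists_sum_eq
  obtain ⟨x, y, hxy, rfl⟩ := Finset.card_eq_two.1 hs
  have hx : w x ≠ 0 := hw x (by simp)
  have hy : w y ≠ 0 := hw y (by simp)
  simp only [Finset.sum_pair hxy] at hA
  set S : Finset V := Finset.univ.filter fun v => P x v = P y v with hS
  have hmem : ∀ v, v ∈ S ↔ P x v = P y v := fun v => by simp [hS]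
  have hsame : ∀ u v, u ≠ v → (u ∈ S ↔ v ∈ S) → (G.Adj u v ↔ w x + w y ≠ 0) := by
    intro u v huv hiff
    rw [hmem, hmem] at hiff
    refine adj_iff_ne_zero_of_adjMatrix_eq G ?_
    rw [hA u v huv]
    rcases hP x u with h1 | h1 <;> rcases hP x v with h2 | h2 <;>
      rcases hP y u with h3 | h3 <;> rcases hP y v with h4 | h4 <;>
      rw [h1, h2, h3, h4] at hiff ⊢ <;> norm_num at hiff <;>
      first | (left; ring1) | (right; ring1)
  have hdiff : ∀ u v, ¬(u ∈ S ↔ v ∈ S) → (G.Adj u v ↔ w x - w y ≠ 0) := by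
    intro u v hiff
    have huv : u ≠ v := by rintro rfl; exact hiff Iff.rfl
    rw [hmem, hmem] at hiff
    refine adj_iff_ne_zero_of_adjMatrix_eq G ?_
    rw [hA u v huv]
    rcases hP x u with h1 | h1 <;> rcases hP x v with h2 | h2 <;>
      rcases hP y u with h3 | h3 <;> rcases hP y v with h4 | h4 <;>
      rw [h1, h2, h3, h4] at hiff ⊢ <;> norm_num at hiff <;>
      first | (left; ring1) | (right; ring1)
  have hnt : ¬ ∀ u v, (u ∈ S ↔ v ∈ S) := by
    intro hall
    by_cases h0 : w x + w y = 0
    · refine hbot (SimpleGraph.eq_bot_iff_forall_not_adj.2 fun u v huv => ?_)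
      exact (hsame u v huv.ne (hall u v)).1 huv h0
    · exact htop (SimpleGraph.eq_top_iff_forall_ne_adj.2 fun u v huv =>
        (hsame u v huv (hall u v)).2 h0)
  refine ⟨S, ?_, ?_, ?_⟩
  · by_contra! hne
    exact hnt fun u v => by simp [hne]
  · by_contra! hne
    exact hnt fun u v => by simp [hne]
  by_cases hd : w x - w y = 0
  · left
    have h0 : w x + w y ≠ 0 := fun h0 => hx (by linarith)
    intro u v
    by_cases huv : u = v
    · simp [huv]
    by_cases hiff : u ∈ S ↔ v ∈ S
    · simp [hsame u v huv hiff, h0, huv, hiff]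
    · simp [hdiff u v hiff, hd, hiff]
  · right
    have h0 : w x + w y = 0 := by
      by_contra h0
      refine htop (SimpleGraph.eq_top_iff_forall_ne_adj.2 fun u v huv => ?_)
      by_cases hiff : u ∈ S ↔ v ∈ S
      · exact (hsame u v huv hiff).2 h0
      · exact (hdiff u v hiff).2 hd
    intro u v
    by_cases huv : u = v
    · simp [huv]
    by_cases hiff : u ∈ S ↔ v ∈ S
    · simp [hsame u v huv hiff, h0, hiff]
    · simp [hdiff u v hiff, hd, hiff]

lemma gc_adjMatrix_eq_two_iff :
    gc (G.adjMatrix ℝ) = 2 ↔ GCFeasible (G.adjMatrix ℝ) 2 ∧ G ≠ ⊥ ∧ G ≠ ⊤ := by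
  unfold gc
  constructor
  · intro h
    refine ⟨?_, fun hG => ?_, fun hG => ?_⟩
    · have hne := Nat.nonempty_of_sInf_eq_succ h
      simpa [h] using Nat.sInf_mem hne
    · have := Nat.sInf_le (s := {m | GCFeasible (G.adjMatrix ℝ) m})
        ((gcFeasible_adjMatrix_zero_iff G).2 hG)
      lia
    · have := Nat.sInf_le (s := {m | GCFeasible (G.adjMatrix ℝ) m})
        (gcFeasible_adjMatrix_one_of_eq_top G hG)
      lia
  · rintro ⟨h, hbot, htop⟩
    refine (IsLeast.csInf_eq ⟨h, fun m hm => ?_⟩)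
    by_contra! hlt
    interval_cases m
    · exact hbot ((gcFeasible_adjMatrix_zero_iff G).1 hm)
    · exact htop (eq_top_of_gcFeasible_adjMatrix_one G hm)

end Feasibility

/-- For a bipartition into two nonempty parts that are not both singletons, some part contains two
vertices and some pair of vertices is separated. -/
lemma exists_pair_of_card {n : ℕ} {S : Finset (Fin n)} {a b : ℕ} (ha : 1 ≤ a) (hb : 1 ≤ b)
    (hab : (a, b) ≠ (1, 1)) (hn : a + b = n) (hS : S.card = a) :
    (∃ u v, u ≠ v ∧ (u ∈ S ↔ v ∈ S)) ∧ ∃ u v, ¬(u ∈ S ↔ v ∈ S) := by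
  have hSc : Sᶜ.card = b := by rw [Finset.card_compl, Fintype.card_fin]; lia
  constructor
  · have h : 1 < a ∨ 1 < b := by
      by_contra! h
      exact hab (Prod.ext (by simp; lia) (by simp; lia))
    rcases h with h | h
    · obtain ⟨u, hu, v, hv, huv⟩ := Finset.one_lt_card.1 (hS ▸ h)
      exact ⟨u, v, huv, by simp [hu, hv]⟩
    · obtain ⟨u, hu, v, hv, huv⟩ := Finset.one_lt_card.1 (hSc ▸ h)
      rw [Finset.mem_compl] at hu hv
      exact ⟨u, v, huv, by simp [hu, hv]⟩
  · obtain ⟨u, hu⟩ := Finset.card_pos.1 (hS ▸ ha : 0 < S.card)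
    obtain ⟨v, hv⟩ := Finset.card_pos.1 (hSc ▸ hb : 0 < Sᶜ.card)
    rw [Finset.mem_compl] at hv
    exact ⟨u, v, by simp [hu, hv]⟩


/-- Theorem: gc(G) = 2 iff G is a disjoint union of two cliques K_a ∪ K_b or a
complete bipartite graph K_{a,b}, with (a,b) ≠ (1,1). -/
theorem gc_eq_two_iff {n : ℕ} (G : SimpleGraph (Fin n)) :
    gcGraph G = 2 ↔
      ∃ a b : ℕ, 1 ≤ a ∧ 1 ≤ b ∧ (a, b) ≠ (1, 1) ∧ a + b = n ∧
        ∃ S : Finset (Fin n), S.card = a ∧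
          ((∀ u v, G.Adj u v ↔ u ≠ v ∧ (u ∈ S ↔ v ∈ S)) ∨
           (∀ u v, G.Adj u v ↔ ¬(u ∈ S ↔ v ∈ S))) := by
  classical
  have hgc : gcGraph G = gc (G.adjMatrix ℝ) := by
    unfold gcGraph
    congr 1
  rw [hgc, gc_adjMatrix_eq_two_iff]
  constructor
  · rintro ⟨h, hbot, htop⟩
    obtain ⟨S, ⟨u, hu⟩, ⟨v, hv⟩, hG⟩ :=
      exists_bipartition_of_gcFeasible_adjMatrix_two G h hbot htop
    refine ⟨S.card, Sᶜ.card, Finset.card_pos.2 ⟨u, hu⟩,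
      Finset.card_pos.2 ⟨v, Finset.mem_compl.2 hv⟩, ?_, by simp [Finset.card_add_card_compl], S,
      rfl, hG⟩
    intro hone
    rw [Prod.mk.injEq, Finset.card_eq_one, Finset.card_eq_one] at hone
    obtain ⟨⟨x, hx⟩, ⟨y, hy⟩⟩ := hone
    have hS : ∀ z, z ∈ S ↔ z = x := by simp [hx]
    have hSc : ∀ z, z ∉ S ↔ z = y := fun z => by rw [← Finset.mem_compl, hy, Finset.mem_singleton]
    have hsep : ∀ i j, i ≠ j → ¬(i ∈ S ↔ j ∈ S) := by
      intro i j hij hiff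
      by_cases hi : i ∈ S
      · exact hij (((hS i).1 hi).trans ((hS j).1 (hiff.1 hi)).symm)
      · exact hij (((hSc i).1 hi).trans ((hSc j).1 (mt hiff.2 hi)).symm)
    rcases hG with hG | hG
    · refine hbot (SimpleGraph.eq_bot_iff_forall_not_adj.2 fun i j hij => ?_)
      exact hsep i j hij.ne ((hG i j).1 hij).2
    · exact htop (SimpleGraph.eq_top_iff_forall_ne_adj.2 fun i j hij =>
        (hG i j).2 (hsep i j hij))
  · rintro ⟨a, b, ha, hb, hab, hn, S, hS, hG⟩
    obtain ⟨⟨u, v, huv, hsame⟩, x, y, hdiff⟩ := exists_pair_of_card ha hb hab hn hS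
    have hxy : x ≠ y := by rintro rfl; exact hdiff Iff.rfl
    refine ⟨gcFeasible_adjMatrix_two_of_bipartition G S hG, ?_, ?_⟩
    · rintro rfl
      rcases hG with hG | hG
      · exact (hG u v).2 ⟨huv, hsame⟩
      · exact (hG x y).2 hdiff
    · rintro rfl
      rcases hG with hG | hG
      · exact hdiff ((hG x y).1 hxy).2
      · exact (hG u v).1 huv hsame
end

section
/- Let H be a simple undirected graph and let H̄ denote its complement on the same vertex set. Then |gc(H) − gc(H̄)| ≤ 1. -/
open Matrix

/-- Adding an all-ones row of weight one and negating the other weights turns a representation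
of `A` into a representation of `J - A`. -/
theorem GCFeasible.one_sub {V : Type*} [Fintype V] {A B : Matrix V V ℝ} {m : ℕ}
    (h : GCFeasible A m) (hdiag : ∀ i, B i i = 0) (hoff : ∀ i j, i ≠ j → B i j = 1 - A i j) :
    GCFeasible B (m + 1) := by
  obtain ⟨k, P, w, hP, -, hA, rfl⟩ := h
  refine ⟨k + 1, Matrix.of fun p i => (Fin.cons 1 fun q => P q i : Fin (k + 1) → ℝ) p,
    Fin.cons 1 fun p => -w p, ?_, hdiag, ?_, ?_⟩
  · intro p i
    refine Fin.cases ?_ (fun q => ?_) p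
    · simp
    · simpa using hP q i
  · intro i j hij
    rw [hoff i j hij, hA i j hij, Matrix.mul_apply, Matrix.mul_apply]
    simp [Matrix.mul_diagonal, Fin.sum_univ_succ, sub_eq_add_neg]
  · rw [Fin.card_filter_univ_succ]
    simp

theorem gc_le_gc_add_one {V : Type*} [Fintype V] {A B : Matrix V V ℝ}
    (hA : ∀ i, A i i = 0) (hB : ∀ i, B i i = 0) (hAB : ∀ i j, i ≠ j → A i j + B i j = 1) :
    gc B ≤ gc A + 1 := by
  rcases Set.eq_empty_or_nonempty { m | GCFeasible A m } with hempty | hne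
  · have hBempty : { m | GCFeasible B m } = ∅ := by
      refine Set.eq_empty_of_forall_notMem fun m hm => ?_
      exact (Set.ext_iff.mp hempty (m + 1)).mp
        (GCFeasible.one_sub hm hA fun i j hij => by linarith [hAB i j hij])
    simp [gc, hBempty]
  · exact Nat.sInf_le
      (GCFeasible.one_sub (Nat.sInf_mem hne) hB fun i j hij => by linarith [hAB i j hij])

theorem gcGraph_compl_le {V : Type*} [Fintype V] (G : SimpleGraph V) :
    gcGraph Gᶜ ≤ gcGraph G + 1 := by
  refine gc_le_gc_add_one (by simp) (by simp) fun i j hij => ?_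
  by_cases h : G.Adj i j <;> simp [h, hij]

/-- Corollary: |gc(H) − gc(H̄)| ≤ 1. -/
theorem gc_compl {V : Type*} [Fintype V] (H : SimpleGraph V) :
    |(gcGraph H : ℤ) - (gcGraph Hᶜ : ℤ)| ≤ 1 := by
  have h₁ := gcGraph_compl_le H
  have h₂ := gcGraph_compl_le Hᶜ
  rw [compl_compl] at h₂
  rw [abs_le]
  omega
end

section
/- Let G be a simple undirected graph with adjacency matrix A. Then min over α ∈ ℝ of rank(A + α·I) is at most gc(G), where I is the identity matrix. -/
open Matrix

theorem GCFeasible.rank_le {V : Type*} [Fintype V] [DecidableEq V] {A : Matrix V V ℝ} {m : ℕ}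
    (h : GCFeasible A m) : ∃ α : ℝ, (A + α • (1 : Matrix V V ℝ)).rank ≤ m := by
  obtain ⟨k, P, w, hP, hdiag, hoff, rfl⟩ := h
  refine ⟨∑ p, w p, ?_⟩
  have hA : A + (∑ p, w p) • (1 : Matrix V V ℝ) = Pᵀ * diagonal w * P := by
    ext i j
    by_cases hij : i = j
    · subst hij
      rw [mul_apply]
      simp only [Matrix.add_apply, Matrix.smul_apply, one_apply_eq, hdiag, mul_diagonal, transpose_apply,
        smul_eq_mul, mul_one, zero_add]
      refine Finset.sum_congr rfl fun p _ => ?_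
      rcases hP p i with h | h <;> simp [h]
    · simp [hij, hoff i j hij]
  rw [hA]
  calc (Pᵀ * diagonal w * P).rank ≤ (Pᵀ * diagonal w).rank := rank_mul_le_left _ _
    _ ≤ (diagonal w).rank := rank_mul_le_right _ _
    _ = _ := by rw [rank_diagonal, Fintype.card_subtype]

/-- It suffices to find a graph coupling indexed by an arbitrary finite type. -/
theorem exists_gcFeasible_of_fintype {V ι : Type*} [Fintype V] [Fintype ι] {A : Matrix V V ℝ}
    (P : ι → V → ℝ) (w : ι → ℝ) (hP : ∀ p i, P p i = 1 ∨ P p i = -1) (hA : ∀ i, A i i = 0)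
    (h : ∀ i j, i ≠ j → A i j = ∑ p, w p * (P p i * P p j)) : ∃ m, GCFeasible A m := by
  let e := (Fintype.equivFin ι).symm
  refine ⟨_, Fintype.card ι, of fun p => P (e p), w ∘ e, fun p i => hP _ _, hA, ?_, rfl⟩
  intro i j hij
  rw [h i j hij, mul_apply, ← e.sum_comp]
  refine Finset.sum_congr rfl fun p _ => ?_
  simp only [mul_diagonal, transpose_apply, of_apply, Function.comp_apply]
  ring

/-- Flip signs of the all-ones vector at `u` and `v`. The mixed second difference of the rank-one
matrices so obtained is supported at the entries `(u, v)` and `(v, u)`. -/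
theorem sum_sign_flips {V : Type*} [DecidableEq V] {u v i j : V} (huv : u ≠ v) (hij : i ≠ j) :
    ∑ s : ℤˣ × ℤˣ, ((s.1 : ℤ) : ℝ) * ((s.2 : ℤ) : ℝ) *
      ((if i = u then ((s.1 : ℤ) : ℝ) else if i = v then ((s.2 : ℤ) : ℝ) else 1) *
        (if j = u then ((s.1 : ℤ) : ℝ) else if j = v then ((s.2 : ℤ) : ℝ) else 1)) =
      (if u = i ∧ v = j then 4 else 0) + (if u = j ∧ v = i then 4 else 0) := by
  simp only [Fintype.sum_prod_type, UnitsInt.univ, Finset.sum_insert, Finset.mem_singleton,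
    Finset.sum_singleton, show (1 : ℤˣ) ≠ -1 by decide, not_false_eq_true]
  by_cases h1 : i = u <;> by_cases h2 : i = v <;> by_cases h3 : j = u <;> by_cases h4 : j = v <;>
    simp_all <;> grind

theorem exists_gcFeasible {V : Type*} [Fintype V] [DecidableEq V] {A : Matrix V V ℝ}
    (hsymm : A.IsSymm) (hA : ∀ i, A i i = 0) : ∃ m, GCFeasible A m := by
  refine exists_gcFeasible_of_fintype (ι := (V × V) × (ℤˣ × ℤˣ))
    (fun p i => if i = p.1.1 then ((p.2.1 : ℤ) : ℝ) else if i = p.1.2 then ((p.2.2 : ℤ) : ℝ) else 1)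
    (fun p => A p.1.1 p.1.2 / 8 * (((p.2.1 : ℤ) : ℝ) * ((p.2.2 : ℤ) : ℝ))) ?_ hA ?_
  · rintro ⟨⟨u, v⟩, s, t⟩ i
    rcases Int.units_eq_one_or s with rfl | rfl <;> rcases Int.units_eq_one_or t with rfl | rfl <;>
      dsimp only <;> split_ifs <;> simp
  · intro i j hij
    have key : ∀ q : V × V, (∑ s : ℤˣ × ℤˣ, A q.1 q.2 / 8 * (((s.1 : ℤ) : ℝ) * ((s.2 : ℤ) : ℝ)) *
        ((if i = q.1 then ((s.1 : ℤ) : ℝ) else if i = q.2 then ((s.2 : ℤ) : ℝ) else 1) *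
          (if j = q.1 then ((s.1 : ℤ) : ℝ) else if j = q.2 then ((s.2 : ℤ) : ℝ) else 1))) =
        (if q = (i, j) then A i j / 2 else 0) + (if q = (j, i) then A i j / 2 else 0) := by
      rintro ⟨u, v⟩
      simp only [mul_assoc (A u v / 8), ← Finset.mul_sum, Prod.mk.injEq]
      by_cases huv : u = v
      · subst huv
        grind
      · rw [sum_sign_flips huv hij]
        have := hsymm.apply i j
        grind
    rw [Fintype.sum_prod_type]
    simp only [key, Finset.sum_add_distrib, Finset.sum_ite_eq', Finset.mem_univ, if_true]
    ring

/-- Theorem: min over α ∈ ℝ of rank(A + α·I) is at most gc(G). -/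
theorem rank_lower_bound {n : ℕ} (G : SimpleGraph (Fin n)) [DecidableRel G.Adj] :
    sInf {r : ℕ | ∃ α : ℝ,
        r = (G.adjMatrix ℝ + α • (1 : Matrix (Fin n) (Fin n) ℝ)).rank}
      ≤ gcGraph G := by
  have hgc : gcGraph G = gc (G.adjMatrix ℝ) := by
    unfold gcGraph
    congr 1
    ext u v
    simp [SimpleGraph.adjMatrix_apply]
  have hmem : GCFeasible (G.adjMatrix ℝ) (gc (G.adjMatrix ℝ)) :=
    Nat.sInf_mem (s := {m | GCFeasible (G.adjMatrix ℝ) m})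
      (exists_gcFeasible (G.isSymm_adjMatrix (α := ℝ)) (by simp))
  obtain ⟨α, hα⟩ := hmem.rank_le
  rw [hgc]
  exact le_trans (Nat.sInf_le ⟨α, rfl⟩) hα
end

section
/- For all natural numbers q and n with q ≤ n, the graph on n vertices consisting of a clique on q vertices together with n − q isolated vertices satisfies gc(K_q ∪ K̄_{n−q}) ≤ q + 2. -/
open Matrix

/-- The graph on Fin n consisting of a clique on the first q vertices together
with n − q isolated vertices. -/
def cliqueUnionGraph (n q : ℕ) : SimpleGraph (Fin n) :=
  SimpleGraph.fromRel fun u v => u.val < q ∧ v.val < q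

theorem gc_le_of_representation {V : Type*} [Fintype V] {A : Matrix V V ℝ} {k : ℕ}
    (P : Matrix (Fin k) V ℝ) (w : Fin k → ℝ) (hP : ∀ p i, P p i = 1 ∨ P p i = -1)
    (hdiag : ∀ i, A i i = 0) (hA : ∀ i j, i ≠ j → A i j = ∑ p, w p * (P p i * P p j)) :
    gc A ≤ k := by
  have hcard : (Finset.univ.filter fun p => w p ≠ 0).card ≤ k :=
    (Finset.card_filter_le _ _).trans_eq (Finset.card_fin k)
  have hfeas : GCFeasible A (Finset.univ.filter fun p => w p ≠ 0).card := by
    refine ⟨k, P, w, hP, hdiag, fun i j hij => ?_, rfl⟩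
    rw [hA i j hij, Matrix.mul_apply]
    refine Finset.sum_congr rfl fun p _ => ?_
    rw [Matrix.mul_diagonal, Matrix.transpose_apply]
    ring
  exact (Nat.sInf_le hfeas).trans hcard

theorem sum_ite_val_eq (q a : ℕ) :
    ∑ p : Fin q, (if a = p.val then (1 : ℝ) else 0) = if a < q then 1 else 0 := by
  rw [Fin.sum_univ_eq_sum_range (fun p => if a = p then (1 : ℝ) else 0)]
  simp

theorem sum_flip_mul_flip (q : ℕ) {a b : ℕ} (hab : a ≠ b) :
    ∑ p : Fin q, (if a = p.val then (-1 : ℝ) else 1) * (if b = p.val then -1 else 1) =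
      q - 2 * (if a < q then 1 else 0) - 2 * (if b < q then 1 else 0) := by
  have key : ∀ p : Fin q,
      (if a = p.val then (-1 : ℝ) else 1) * (if b = p.val then -1 else 1) =
        1 - 2 * (if a = p.val then 1 else 0) - 2 * (if b = p.val then 1 else 0) := by
    intro p
    by_cases ha : a = p.val
    · have hb : b ≠ p.val := fun hb => hab (ha.trans hb.symm)
      simp only [if_pos ha, if_neg hb]
      norm_num
    · by_cases hb : b = p.val
      · simp only [if_neg ha, if_pos hb]
        norm_num
      · simp only [if_neg ha, if_neg hb]
        norm_num
  simp only [key, Finset.sum_sub_distrib, ← Finset.mul_sum, sum_ite_val_eq]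
  simp

/-- Sign vectors on `Fin n`: the first `q` flip one clique vertex each, the next flips nothing,
and the last flips the whole clique. -/
def cliqueSigns (n q : ℕ) : Matrix (Fin (q + 2)) (Fin n) ℝ :=
  Matrix.of <| Fin.snoc (α := fun _ => Fin n → ℝ)
    (Fin.snoc (α := fun _ => Fin n → ℝ)
      (fun (p : Fin q) (i : Fin n) => if i.val = p.val then -1 else 1) fun _ => 1)
    fun i => if i.val < q then -1 else 1

/-- The weights of the rows of `cliqueSigns`. -/
noncomputable def cliqueWeights (q : ℕ) : Fin (q + 2) → ℝ :=
  Fin.snoc (α := fun _ => ℝ) (Fin.snoc (α := fun _ => ℝ) (fun _ : Fin q => -1 / 4)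
    (((q : ℝ) - 1) / 4)) (1 / 4)

/-- Theorem: for q ≤ n, gc(K_q ∪ K̄_{n−q}) ≤ q + 2. -/
theorem clique_upper {n q : ℕ} (h : q ≤ n) :
    gcGraph (cliqueUnionGraph n q) ≤ q + 2 := by
  refine gc_le_of_representation (cliqueSigns n q) (cliqueWeights q) ?_ (by simp) ?_
  · intro p i
    refine Fin.lastCases ?_ (fun p => Fin.lastCases ?_ (fun p => ?_) p) p
    · simp only [cliqueSigns, Matrix.of_apply, Fin.snoc_last]
      split_ifs <;> simp
    · simp [cliqueSigns]
    · simp only [cliqueSigns, Matrix.of_apply, Fin.snoc_castSucc]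
      split_ifs <;> simp
  · intro i j hij
    simp only [Fin.sum_univ_castSucc, cliqueSigns, cliqueWeights, Matrix.of_apply,
      Fin.snoc_castSucc, Fin.snoc_last, ← Finset.mul_sum,
      sum_flip_mul_flip q (Fin.val_ne_of_ne hij)]
    by_cases hi : i.val < q <;> by_cases hj : j.val < q <;>
      simp [cliqueUnionGraph, hij, hi, hj] <;> ring
end

section
/- Let S_1, S_2, …, S_q be a partition of the vertex set of a graph G such that each S_i induces a clique and G has no other edges; that is, G = K_{S_1} ∪ K_{S_2} ∪ ⋯ ∪ K_{S_q} is a vertex-disjoint union of q cliques. Then gc(G) ≤ q + 1. -/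
open Matrix

/-- The star cut vectors (`-1` at one index, `1` elsewhere) are close to orthogonal. -/
lemma sum_star_mul_star {ι : Type*} [Fintype ι] [DecidableEq ι] (a b : ι) :
    ∑ i, (if a = i then (-1 : ℝ) else 1) * (if b = i then -1 else 1) =
      Fintype.card ι - 4 + if a = b then 4 else 0 := by
  have expand (i : ι) : (if a = i then (-1 : ℝ) else 1) * (if b = i then -1 else 1) =
      1 - (if a = i then 2 else 0) - (if b = i then 2 else 0) +
        (if a = i then (if b = i then 4 else 0) else 0) := by
    split_ifs <;> norm_num
  simp only [expand, Finset.sum_add_distrib, Finset.sum_sub_distrib, Finset.sum_ite_eq,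
    Finset.mem_univ, if_true, Finset.sum_const, Finset.card_univ, nsmul_eq_mul, mul_one]
  rw [if_congr (eq_comm (a := b)) rfl rfl]
  ring

lemma gc_le_of_gcFeasible {V : Type*} [Fintype V] {A : Matrix V V ℝ} {m : ℕ}
    (h : GCFeasible A m) : gc A ≤ m :=
  Nat.sInf_le h

/-- Theorem: if the vertex set of G is partitioned into q blocks (the fibers of a
surjective map f), and two distinct vertices are adjacent exactly when they lie in
the same block (so G is a vertex-disjoint union of q cliques), then gc(G) ≤ q + 1. -/
theorem disjoint_cliques_upper {n q : ℕ} (G : SimpleGraph (Fin n))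
    (f : Fin n → Fin q) (hf : Function.Surjective f)
    (hadj : ∀ u v, G.Adj u v ↔ u ≠ v ∧ f u = f v) :
    gcGraph G ≤ q + 1 := by
  refine (gc_le_of_gcFeasible ⟨q + 1,
    Matrix.of fun p v => Fin.cases 1 (fun i => if f v = i then -1 else 1) p,
    Fin.cases ((4 - q) / 4) (fun _ => 1 / 4), fun p v => ?_, fun v => ?_, fun u v huv => ?_,
    rfl⟩).trans ((Finset.card_le_univ _).trans_eq (Fintype.card_fin _))
  · cases p using Fin.cases with
    | zero => simp
    | succ i => by_cases h : f v = i <;> simp [h]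
  · simp
  · have star := sum_star_mul_star (f u) (f v)
    simp only [Fintype.card_fin] at star
    rw [Matrix.mul_apply]
    simp only [Matrix.mul_diagonal, Matrix.transpose_apply, Matrix.of_apply,
      Fin.sum_univ_succ, Fin.cases_zero, Fin.cases_succ, mul_right_comm _ (1 / 4 : ℝ),
      ← Finset.sum_mul, star, hadj, ne_eq, huv, not_false_eq_true, true_and]
    split_ifs <;> ring
end

section
/- For all q ∈ ℕ, the perfect matching graph PM_q satisfies gc(PM_q) ≤ q + 1. -/
open Matrix

/-- The perfect matching graph PM_q on 2q vertices: vertex 2i is matched to 2i+1. -/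
def perfectMatchingGraph (q : ℕ) : SimpleGraph (Fin (2 * q)) :=
  SimpleGraph.fromRel fun u v => u.val / 2 = v.val / 2

/-- Sign vectors on `Fin q` with a single negative entry, at `a` and at `b`, have inner product
`(q - 4) / 4`, plus one if `a = b`, when every coordinate has weight `1 / 4`. -/
theorem sum_sign_mul_sign {q : ℕ} (a b : Fin q) :
    ∑ p : Fin q, (if p = a then (-1 : ℝ) else 1) * (1 / 4) * (if p = b then -1 else 1) =
      (q - 4) / 4 + if a = b then 1 else 0 := by
  have h : ∀ p : Fin q, (if p = a then (-1 : ℝ) else 1) * (1 / 4) * (if p = b then -1 else 1) =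
      1 / 4 - (if p = a then 1 / 2 else 0) - (if p = b then 1 / 2 else 0) +
        if p = a then (if a = b then 1 else 0) else 0 := by
    intro p
    split_ifs <;> first | (norm_num; done) | simp_all
  simp only [h, Finset.sum_add_distrib, Finset.sum_sub_distrib, Finset.sum_ite_eq',
    Finset.sum_const, Finset.mem_univ, Finset.card_univ, Fintype.card_fin, if_true, nsmul_eq_mul]
  ring

/-- Corollary: gc(PM_q) ≤ q + 1. -/
theorem pm_upper (q : ℕ) : gcGraph (perfectMatchingGraph q) ≤ q + 1 := by
  let pair : Fin (2 * q) → Fin q := fun u => ⟨u.val / 2, by omega⟩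
  let P : Matrix (Fin (q + 1)) (Fin (2 * q)) ℝ :=
    Matrix.of fun p u => if p = (pair u).castSucc then -1 else 1
  let w : Fin (q + 1) → ℝ := Fin.snoc (fun _ => 1 / 4) ((4 - q) / 4)
  suffices hP : GCFeasible _ (Finset.univ.filter fun p => w p ≠ 0).card from
    (Nat.sInf_le hP).trans ((Finset.card_le_univ _).trans_eq (Fintype.card_fin _))
  refine ⟨q + 1, P, w, ?_, ?_, ?_, rfl⟩
  · intro p u
    simp only [P, Matrix.of_apply]
    split_ifs <;> simp
  · simp
  · intro u v huv
    have hadj : (perfectMatchingGraph q).Adj u v ↔ pair u = pair v := by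
      simp only [perfectMatchingGraph, SimpleGraph.fromRel_adj, pair, Fin.mk.injEq]
      exact ⟨fun h => h.2.elim id Eq.symm, fun h => ⟨huv, Or.inl h⟩⟩
    have hlast (a : Fin q) : Fin.last q ≠ a.castSucc := (Fin.castSucc_lt_last a).ne'
    rw [Matrix.mul_apply, Fin.sum_univ_castSucc]
    simp only [Matrix.mul_diagonal, Matrix.transpose_apply, Matrix.of_apply, P, w,
      Fin.snoc_castSucc, Fin.snoc_last, Fin.castSucc_inj, hlast, if_false, hadj,
      sum_sign_mul_sign]
    ring
end

section
/- For all n ∈ ℕ with n ≥ 3, the cycle graph C_n on n vertices satisfies gc(C_n) ≤ n + 1. -/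
open Matrix

/-- The cycle graph C_n on n vertices, with edges {i, i+1 mod n}. -/
def cycleGraphFin (n : ℕ) : SimpleGraph (Fin n) :=
  SimpleGraph.fromRel fun u v => (u.val + 1) % n = v.val

theorem Fin.val_add_one_mod_eq_iff {m : ℕ} (u v : Fin (m + 3)) :
    (u.val + 1) % (m + 3) = v.val ↔ v = u + 1 := by
  rw [Fin.ext_iff, Fin.val_add, Fin.val_one, eq_comm]

theorem cycleGraphFin_adj_iff {m : ℕ} {u v : Fin (m + 3)} (huv : u ≠ v) :
    (cycleGraphFin (m + 3)).Adj u v ↔ v = u + 1 ∨ u = v + 1 := by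
  simp only [cycleGraphFin, SimpleGraph.fromRel_adj, Fin.val_add_one_mod_eq_iff]
  tauto

/-- The sign vector of the cut separating the consecutive vertices `p`, `p + 1` from the others. -/
def pairCutSign {m : ℕ} (p i : Fin (m + 3)) : ℝ :=
  if i = p ∨ i = p + 1 then -1 else 1

theorem pairCutSign_eq {m : ℕ} (p i : Fin (m + 3)) :
    pairCutSign p i = 1 - 2 * ((if p = i then 1 else 0) + (if p = i - 1 then 1 else 0)) := by
  have h1 : i = p ↔ p = i := eq_comm
  have h2 : i = p + 1 ↔ p = i - 1 := by rw [eq_sub_iff_add_eq, eq_comm]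
  have h3 : i ≠ i - 1 := fun h => by simp [eq_sub_iff_add_eq] at h
  simp only [pairCutSign, h1, h2]
  by_cases hp : p = i
  · subst hp
    rw [if_pos (Or.inl rfl), if_pos rfl, if_neg h3]
    norm_num
  · by_cases hq : p = i - 1
    · rw [if_pos (Or.inr hq), if_neg hp, if_pos hq]
      norm_num
    · rw [if_neg (by tauto), if_neg hp, if_neg hq]
      norm_num

theorem sum_pairCutSign_mul {m : ℕ} {i j : Fin (m + 3)} (hij : i ≠ j) :
    ∑ p, pairCutSign p i * pairCutSign p j =
      (m : ℝ) - 5 + 4 * if j = i + 1 ∨ i = j + 1 then 1 else 0 := by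
  have hexp : ∀ p : Fin (m + 3), pairCutSign p i * pairCutSign p j =
      1 - 2 * (if p = i then 1 else 0) - 2 * (if p = i - 1 then 1 else 0)
        - 2 * (if p = j then 1 else 0) - 2 * (if p = j - 1 then 1 else 0)
        + 4 * (if p = i then (if i = j then 1 else 0) + (if i = j - 1 then 1 else 0) else 0)
        + 4 * (if p = i - 1 then
            (if i - 1 = j then 1 else 0) + (if i - 1 = j - 1 then 1 else 0) else 0) := by
    intro p
    rw [pairCutSign_eq, pairCutSign_eq]
    have e (a : Fin (m + 3)) :
        (if p = a then (if a = j then (1 : ℝ) else 0) + (if a = j - 1 then 1 else 0) else 0) =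
        (if p = a then 1 else 0) * ((if p = j then 1 else 0) + (if p = j - 1 then 1 else 0)) := by
      by_cases h : p = a
      · subst h; simp
      · simp [h]
    rw [e i, e (i - 1)]
    ring
  have h1 : i = j - 1 ↔ j = i + 1 := by rw [eq_sub_iff_add_eq, eq_comm]
  have h2 : i - 1 = j ↔ i = j + 1 := sub_eq_iff_eq_add
  have h3 : ¬ (j = i + 1 ∧ i = j + 1) := by
    rintro ⟨h, h'⟩
    rw [h, add_assoc, left_eq_add] at h'
    have := congrArg Fin.val h'
    simp [Fin.val_add, Nat.mod_eq_of_lt] at this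
  simp only [hexp, Finset.sum_add_distrib, Finset.sum_sub_distrib, ← Finset.mul_sum,
    Finset.sum_ite_eq', Finset.mem_univ, if_true, sub_left_inj, if_neg hij,
    h1, h2, Finset.sum_const, Finset.card_univ, Fintype.card_fin, nsmul_eq_mul]
  push_cast
  split_ifs <;> first | (exfalso; tauto) | ring

/-- Corollary: for n ≥ 3, gc(C_n) ≤ n + 1. -/
theorem cycle_upper {n : ℕ} (h : 3 ≤ n) : gcGraph (cycleGraphFin n) ≤ n + 1 := by
  obtain ⟨m, rfl⟩ := Nat.exists_eq_add_of_le' h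
  let P : Matrix (Fin (m + 3 + 1)) (Fin (m + 3)) ℝ := Fin.cons (fun _ => 1) pairCutSign
  let w : Fin (m + 3 + 1) → ℝ := Fin.cons ((5 - m) / 4) fun _ => 1 / 4
  suffices hP : GCFeasible _ (Finset.univ.filter fun p => w p ≠ 0).card from
    (Nat.sInf_le hP).trans ((Finset.card_le_univ _).trans (by simp))
  refine ⟨m + 3 + 1, P, w, ?_, ?_, ?_, rfl⟩
  · intro p i
    cases p using Fin.cases with
    | zero => exact Or.inl rfl
    | succ p =>
      change pairCutSign p i = 1 ∨ pairCutSign p i = -1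
      unfold pairCutSign
      split_ifs <;> simp
  · simp
  · intro i j hij
    have hsum : (Pᵀ * Matrix.diagonal w * P) i j =
        (5 - m) / 4 + 1 / 4 * ∑ p, pairCutSign p i * pairCutSign p j := by
      rw [Matrix.mul_apply]
      simp only [Matrix.mul_diagonal, Matrix.transpose_apply]
      rw [Fin.sum_univ_succ, Finset.mul_sum]
      simp only [P, w, Fin.cons_zero, Fin.cons_succ]
      congr 1
      · ring
      · exact Finset.sum_congr rfl fun p _ => by ring
    rw [hsum, sum_pairCutSign_mul hij]
    simp only [Matrix.of_apply, cycleGraphFin_adj_iff hij]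
    split_ifs <;> ring
end

section
/- For all n ∈ ℕ, the path graph P_n on n vertices satisfies gc(P_n) ≤ n + 2. -/
open Matrix

/-- The path graph P_n on n vertices, with edges {i, i+1}. -/
def pathGraphFin (n : ℕ) : SimpleGraph (Fin n) :=
  SimpleGraph.fromRel fun u v => u.val + 1 = v.val

/-- The sign vectors of a coupling of the path: row `p` is negative exactly at `p - 1` and `p`. -/
def pathSigns (n : ℕ) (p : Fin (n + 1)) (i : Fin n) : ℝ :=
  1 - 2 * ((if p = i.castSucc then 1 else 0) + (if p = i.succ then 1 else 0))

lemma pathSigns_eq_or (n : ℕ) (p : Fin (n + 1)) (i : Fin n) :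
    pathSigns n p i = 1 ∨ pathSigns n p i = -1 := by
  unfold pathSigns
  by_cases h : p = i.castSucc
  · right
    have h' : p ≠ i.succ := by rw [h]; exact (Fin.castSucc_lt_succ).ne
    rw [if_pos h, if_neg h']
    norm_num
  · rw [if_neg h]
    split_ifs <;> norm_num

lemma sum_pathSigns_mul (n : ℕ) {i j : Fin n} (hij : i ≠ j) :
    ∑ p, pathSigns n p i * pathSigns n p j =
      n - 7 + 4 * (if i.val + 1 = j.val ∨ j.val + 1 = i.val then 1 else 0) := by
  have hval : i.val ≠ j.val := fun h => hij (Fin.ext h)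
  have expand : ∀ p, pathSigns n p i * pathSigns n p j =
      1 - 2 * (if p = i.castSucc then 1 else 0) - 2 * (if p = i.succ then 1 else 0)
      - 2 * (if p = j.castSucc then 1 else 0) - 2 * (if p = j.succ then 1 else 0)
      + 4 * (if p = i.castSucc then (if p = j.castSucc then 1 else 0) else 0)
      + 4 * (if p = i.castSucc then (if p = j.succ then 1 else 0) else 0)
      + 4 * (if p = i.succ then (if p = j.castSucc then 1 else 0) else 0)
      + 4 * (if p = i.succ then (if p = j.succ then 1 else 0) else 0) := by
    intro p
    unfold pathSigns
    split_ifs <;> ring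
  simp only [expand, Finset.sum_add_distrib, Finset.sum_sub_distrib, ← Finset.mul_sum,
    Finset.sum_ite_eq', Finset.sum_const, Finset.mem_univ, if_true, Finset.card_univ,
    Fintype.card_fin, nsmul_eq_mul]
  simp only [Fin.ext_iff, Fin.val_castSucc, Fin.val_succ]
  push_cast
  split_ifs <;> first | omega | ring

/-- Corollary: gc(P_n) ≤ n + 2. -/
theorem path_upper (n : ℕ) : gcGraph (pathGraphFin n) ≤ n + 2 := by
  classical
  let P : Matrix (Fin (n + 2)) (Fin n) ℝ := Fin.snoc (pathSigns n) fun _ => 1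
  let w : Fin (n + 2) → ℝ := Fin.snoc (fun _ => 1 / 4) ((7 - n) / 4)
  have hPc : ∀ p i, P (Fin.castSucc p) i = pathSigns n p i := fun p i => by simp [P]
  have hPl : ∀ i, P (Fin.last (n + 1)) i = 1 := fun i => by simp [P]
  have hcard : (Finset.univ.filter fun p => w p ≠ 0).card ≤ n + 2 :=
    (Finset.card_le_univ _).trans (Fintype.card_fin _).le
  unfold gcGraph gc
  refine le_trans (Nat.sInf_le ?_) hcard
  refine ⟨n + 2, P, w, ?_, ?_, ?_, ?_⟩
  · intro p i
    induction p using Fin.lastCases with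
    | last => simp [hPl]
    | cast p => simpa only [hPc] using pathSigns_eq_or n p i
  · simp
  · intro i j hij
    have hsum : (Pᵀ * Matrix.diagonal w * P) i j =
        1 / 4 * ∑ p, pathSigns n p i * pathSigns n p j + (7 - n) / 4 := by
      rw [Matrix.mul_apply, Fin.sum_univ_castSucc, Finset.mul_sum]
      simp only [Matrix.mul_diagonal, Matrix.transpose_apply, hPc, hPl, w, Fin.snoc_castSucc,
        Fin.snoc_last]
      congr 1
      · exact Finset.sum_congr rfl fun p _ => by ring
      · ring
    rw [hsum, sum_pathSigns_mul n hij]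
    simp only [Matrix.of_apply, pathGraphFin, SimpleGraph.fromRel_adj, ne_eq, hij,
      not_false_eq_true, true_and]
    split_ifs <;> ring
  · congr!
end

section
/- Let G be a simple, undirected, unweighted graph on n vertices whose edge set is the union of: all edges from a vertex v₁ to every vertex of a set V₃, all edges from each of two distinct nonadjacent vertices v₁ and v₂ to every vertex of a set V₄, and all edges from v₂ to every vertex of a set V₅, where V₃, V₄, V₅ together with a (possibly empty) set V₆ of isolated vertices are pairwise disjoint sets not containing v₁ or v₂ (a general double-star graph). Then gc(G) ≤ 6. -/
open Matrix

theorem gc_le_of_feasible {V : Type*} [Fintype V] {A : Matrix V V ℝ} {k : ℕ}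
    (P : Matrix (Fin k) V ℝ) (w : Fin k → ℝ) (hP : ∀ p i, P p i = 1 ∨ P p i = -1)
    (hdiag : ∀ i, A i i = 0)
    (hoff : ∀ i j, i ≠ j → A i j = (Pᵀ * Matrix.diagonal w * P) i j) : gc A ≤ k :=
  (Nat.sInf_le (show GCFeasible A _ from ⟨k, P, w, hP, hdiag, hoff, rfl⟩)).trans
    ((Finset.card_le_univ _).trans_eq (Fintype.card_fin k))

open scoped Classical in
/-- The sign vectors attached to the vertices of a double star. -/
noncomputable def doubleStarSigns {V : Type*} (v₁ v₂ : V) (V₃ V₄ V₅ : Set V) (i : V) :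
    Fin 6 → ℝ :=
  if i = v₁ then ![1, 1, 1, 1, -1, -1]
  else if i = v₂ then ![1, 1, -1, -1, -1, -1]
  else if i ∈ V₃ then ![1, 1, 1, -1, 1, -1]
  else if i ∈ V₄ then ![1, -1, -1, -1, 1, -1]
  else if i ∈ V₅ then ![1, -1, -1, 1, 1, 1]
  else ![1, 1, 1, 1, 1, 1]

/-- Theorem: a general double-star graph — with nonadjacent centers v₁, v₂, leaf
sets V₃ (adjacent only to v₁), V₄ (adjacent to both v₁ and v₂), V₅ (adjacent only
to v₂), and all remaining vertices isolated — satisfies gc(G) ≤ 6. -/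
theorem doubleStar_upper {V : Type*} [Fintype V] (G : SimpleGraph V)
    (v₁ v₂ : V) (hne : v₁ ≠ v₂) (V₃ V₄ V₅ : Set V)
    (h34 : Disjoint V₃ V₄) (h35 : Disjoint V₃ V₅) (h45 : Disjoint V₄ V₅)
    (h1 : v₁ ∉ V₃ ∪ V₄ ∪ V₅) (h2 : v₂ ∉ V₃ ∪ V₄ ∪ V₅)
    (hadj : ∀ u v, G.Adj u v ↔
      ((u = v₁ ∧ v ∈ V₃) ∨ (v = v₁ ∧ u ∈ V₃) ∨
       ((u = v₁ ∨ u = v₂) ∧ v ∈ V₄) ∨ ((v = v₁ ∨ v = v₂) ∧ u ∈ V₄) ∨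
       (u = v₂ ∧ v ∈ V₅) ∨ (v = v₂ ∧ u ∈ V₅))) :
    gcGraph G ≤ 6 := by
  classical
  simp only [Set.mem_union, not_or] at h1 h2
  obtain ⟨⟨h13, h14⟩, h15⟩ := h1
  obtain ⟨⟨h23, h24⟩, h25⟩ := h2
  have d34 : ∀ i ∈ V₃, i ∉ V₄ := fun _ h => Set.disjoint_left.mp h34 h
  have d35 : ∀ i ∈ V₃, i ∉ V₅ := fun _ h => Set.disjoint_left.mp h35 h
  have d45 : ∀ i ∈ V₄, i ∉ V₅ := fun _ h => Set.disjoint_left.mp h45 h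
  have cases_vertex : ∀ i, i = v₁ ∨ i = v₂ ∨
      (i ≠ v₁ ∧ i ≠ v₂ ∧ i ∈ V₃ ∧ i ∉ V₄ ∧ i ∉ V₅) ∨
      (i ≠ v₁ ∧ i ≠ v₂ ∧ i ∉ V₃ ∧ i ∈ V₄ ∧ i ∉ V₅) ∨
      (i ≠ v₁ ∧ i ≠ v₂ ∧ i ∉ V₃ ∧ i ∉ V₄ ∧ i ∈ V₅) ∨
      (i ≠ v₁ ∧ i ≠ v₂ ∧ i ∉ V₃ ∧ i ∉ V₄ ∧ i ∉ V₅) := by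
    intro i
    have := d34 i
    have := d35 i
    have := d45 i
    tauto
  unfold gcGraph
  refine gc_le_of_feasible (Matrix.of fun p i => doubleStarSigns v₁ v₂ V₃ V₄ V₅ i p)
    ![1/4, -1/4, 1/4, -1/4, -1/4, 1/4] ?_ ?_ ?_
  · intro p i
    simp only [Matrix.of_apply, doubleStarSigns]
    split_ifs <;> fin_cases p <;> simp
  · intro i
    simp
  · intro i j hij
    simp only [Matrix.mul_apply, Matrix.transpose_apply, Matrix.of_apply,
      Fin.sum_univ_six, hadj, doubleStarSigns]
    rcases cases_vertex i with rfl | rfl | h | h | h | h <;>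
    rcases cases_vertex j with rfl | rfl | h' | h' | h' | h' <;>
    first
    | exact absurd rfl hij
    | (simp [*, hne.symm]; norm_num)
end
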